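/- Let m,n,p ≥ 3 and let R be the catenation DFA A·(B×C) where A = X_m(a,b,−;{c}), B = X_n(b,a,c;∅), C = X_p(b,−,c;{a}) over the alphabet {a,b,c}. Then every state (i,T) with 0 ≤ i ≤ m−1 and T ⊆ {0,…,n−1}×{0,…,p−1} satisfying the condition (i = m−1 implies (0,0) ∈ T) is reachable from the initial state of R. -/

import Mathlib

/-- The cyclic permutation `i ↦ i+1 mod n` on `{0,…,n−1}`. -/
def cyc {n : ℕ} (i : Fin n) : Fin n := ⟨(i.val + 1) % n, Nat.mod_lt _ i.pos⟩

/-- The transposition exchanging `0` and `1` and fixing all other elements of `{0,…,n−1}`. -/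
def transp {n : ℕ} (i : Fin n) : Fin n :=
  if i.val = 0 then ⟨1 % n, Nat.mod_lt _ i.pos⟩
  else if i.val = 1 then ⟨0, i.pos⟩ else i

/-- The contraction sending `1` to `0` and fixing all other elements of `{0,…,n−1}`. -/
def contr {n : ℕ} (i : Fin n) : Fin n := if i.val = 1 then ⟨0, i.pos⟩ else i

/-- A Brzozowski-type complete DFA: state set `{0,…,n−1}`, initial state `0`,
unique final state `n−1`, where each letter `x` acts as the transformation `f x`. -/
def brzDFA {α : Type} (n : ℕ) (hn : 0 < n) (f : α → Fin n → Fin n) : DFA α (Fin n) where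
  step q x := f x q
  start := ⟨0, hn⟩
  accept := {⟨n - 1, Nat.sub_lt hn Nat.one_pos⟩}

/-- Product DFA of two DFAs, with acceptance given by applying the boolean
connective `o` to the two components' acceptance. -/
def prodDFA {α σB σC : Type} (B : DFA α σB) (C : DFA α σC) (o : Prop → Prop → Prop) :
    DFA α (σB × σC) where
  step q x := (B.step q.1 x, C.step q.2 x)
  start := (B.start, C.start)
  accept := {q | o (q.1 ∈ B.accept) (q.2 ∈ C.accept)}

open Classical in
/-- Catenation DFA of two DFAs. -/
noncomputable def catDFA {α σA σM : Type} (A : DFA α σA) (M : DFA α σM) :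
    DFA α (σA × Set σM) where
  step q x :=
    (A.step q.1 x,
      if A.step q.1 x ∈ A.accept then (fun s => M.step s x) '' q.2 ∪ {M.start}
      else (fun s => M.step s x) '' q.2)
  start := (A.start, if A.start ∈ A.accept then {M.start} else ∅)
  accept := {q | (q.2 ∩ M.accept).Nonempty}

/-- Two states of a DFA are equivalent if no word separates them. -/
def equivStates {α σ : Type} (D : DFA α σ) (q₁ q₂ : σ) : Prop :=
  ∀ w : List α, (D.evalFrom q₁ w ∈ D.accept ↔ D.evalFrom q₂ w ∈ D.accept)

/-- The three-letter alphabet `{a,b,c}`. -/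
inductive ABC | a | b | c

/-- `X_m(a,b,−;{c})`: `a` the cycle, `b` the transposition, `c` the identity. -/
def XA (m : ℕ) (hm : 0 < m) : DFA ABC (Fin m) :=
  brzDFA m hm (fun x q => match x with | ABC.a => cyc q | ABC.b => transp q | ABC.c => q)

/-- `X_n(b,a,c;∅)`: `b` the cycle, `a` the transposition, `c` the contraction. -/
def XB (n : ℕ) (hn : 0 < n) : DFA ABC (Fin n) :=
  brzDFA n hn (fun x q => match x with | ABC.a => transp q | ABC.b => cyc q | ABC.c => contr q)

/-- `X_p(b,−,c;{a})`: `b` the cycle, `c` the contraction, `a` the identity. -/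
def XC (p : ℕ) (hp : 0 < p) : DFA ABC (Fin p) :=
  brzDFA p hp (fun x q => match x with | ABC.a => q | ABC.b => cyc q | ABC.c => contr q)

theorem val_cyc {n : ℕ} (i : Fin n) :
    (cyc i).val = if i.val + 1 = n then 0 else i.val + 1 := by
  have := i.isLt
  simp only [cyc]
  split_ifs with h
  · simp [h]
  · exact Nat.mod_eq_of_lt (by omega)

theorem val_transp {n : ℕ} (hn : 2 ≤ n) (i : Fin n) :
    (transp i).val = if i.val = 0 then 1 else if i.val = 1 then 0 else i.val := by
  have h1 : 1 % n = 1 := Nat.mod_eq_of_lt (by omega)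
  unfold transp
  split_ifs <;> simp [h1]

theorem cyc_bijective {n : ℕ} : Function.Bijective (cyc (n := n)) := by
  refine Finite.injective_iff_bijective.mp fun i j h => ?_
  have h' := congrArg Fin.val h
  rw [val_cyc, val_cyc] at h'
  apply Fin.ext
  split_ifs at h' <;> omega

theorem transp_bijective {n : ℕ} (hn : 2 ≤ n) : Function.Bijective (transp (n := n)) := by
  refine Finite.injective_iff_bijective.mp fun i j h => ?_
  have h' := congrArg Fin.val h
  rw [val_transp hn, val_transp hn] at h'
  apply Fin.ext
  split_ifs at h' <;> omega

/-- Action of the letter `a` on the states of `B × C`. -/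
def swapRow {n p : ℕ} : Fin n × Fin p → Fin n × Fin p := Prod.map transp id

/-- Action of the letter `b` on the states of `B × C`. -/
def shift {n p : ℕ} : Fin n × Fin p → Fin n × Fin p := Prod.map cyc cyc

theorem swapRow_bijective {n p : ℕ} (hn : 2 ≤ n) :
    Function.Bijective (swapRow (n := n) (p := p)) :=
  (transp_bijective hn).prodMap Function.bijective_id

theorem shift_bijective {n p : ℕ} : Function.Bijective (shift (n := n) (p := p)) :=
  cyc_bijective.prodMap cyc_bijective

theorem ncard_preimage_of_bijective {α : Type*} {f : α → α} (hf : Function.Bijective f)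
    (T : Set α) : (f ⁻¹' T).ncard = T.ncard :=
  Set.ncard_preimage_of_injective_subset_range hf.injective (by simp [hf.surjective.range_eq])

/-- A property of states of `B × C` that holds at `(1,0)` and is preserved by the words `bb` and
`ab` holds everywhere. -/
theorem forall_of_shift_shift_of_shift_swapRow {n p : ℕ} (hn : 3 ≤ n) (hp : 0 < p)
    (U : Fin n × Fin p → Prop) (h0 : U (⟨1, by omega⟩, ⟨0, hp⟩))
    (hbb : ∀ x, U x → U (shift (shift x))) (hab : ∀ x, U x → U (shift (swapRow x))) :
    ∀ x, U x := by
  have row_one : ∀ c : ℕ, ∀ hc : c < p, U (⟨1, by omega⟩, ⟨c, hc⟩) := by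
    intro c
    induction c with
    | zero => exact fun _ => h0
    | succ c ih =>
      intro hc
      have h := hab _ (ih (by omega))
      convert h using 1
      refine Prod.ext (Fin.ext ?_) (Fin.ext ?_)
      · simp only [shift, swapRow, Prod.map, val_cyc, val_transp (show 2 ≤ n by omega)]
        simp; omega
      · simp only [shift, swapRow, Prod.map, val_cyc, id]
        rw [if_neg (by omega)]
  have next : ∀ r : Fin n, (∀ c, U (r, c)) → ∀ c, U (cyc (transp r), c) := by
    intro r h c
    obtain ⟨d, rfl⟩ := cyc_bijective.surjective c
    exact hab _ (h d)
  have next_two : ∀ r : Fin n, (∀ c, U (r, c)) → ∀ c, U (cyc (cyc r), c) := by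
    intro r h c
    obtain ⟨d, rfl⟩ := cyc_bijective.surjective c
    obtain ⟨d, rfl⟩ := cyc_bijective.surjective d
    exact hbb _ (h d)
  have up : ∀ s r : ℕ, ∀ hs : s < n, 2 ≤ r → r ≤ s → (∀ hr : r < n, ∀ c, U (⟨r, hr⟩, c)) →
      ∀ c, U (⟨s, hs⟩, c) := by
    intro s r hs hr hrs h
    induction s, hrs using Nat.le_induction with
    | base => exact h hs
    | succ s hrs ih =>
      convert next _ (ih (by omega)) using 4
      rw [val_cyc, val_transp (by omega)]
      simp only
      split_ifs <;> omega
  have row_zero : ∀ c, U (⟨0, by omega⟩, c) := by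
    have h3 := next_two ⟨1, by omega⟩ (fun c => row_one c c.isLt)
    by_cases h : n = 3
    · convert h3 using 4
      simp only [val_cyc]
      split_ifs <;> omega
    · have hl := up (n - 1) 3 (by omega) (by omega) (by omega) (fun hr => by
        convert h3 using 4
        simp only [val_cyc]
        split_ifs <;> omega)
      convert next _ hl using 4
      rw [val_cyc, val_transp (by omega)]
      simp only
      split_ifs <;> omega
  have row_two : ∀ hr : 2 < n, ∀ c, U (⟨2, hr⟩, c) := by
    intro hr
    convert next _ row_zero using 4
    rw [val_cyc, val_transp (by omega)]
    simp only
    split_ifs <;> omega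
  rintro ⟨⟨r, hr⟩, c⟩
  match r, hr with
  | 0, _ => exact row_zero c
  | 1, _ => exact row_one c c.isLt
  | r + 2, hr => exact up _ 2 hr le_rfl (by omega) row_two c

/-- A state of a DFA is reachable if some word leads to it from the initial state. -/
def IsReachable {α σ : Type} (D : DFA α σ) (q : σ) : Prop :=
  ∃ w : List α, D.evalFrom D.start w = q

theorem IsReachable.step {α σ : Type} {D : DFA α σ} {q : σ} (h : IsReachable D q) (x : α) :
    IsReachable D (D.step q x) := by
  obtain ⟨w, rfl⟩ := h
  exact ⟨w ++ [x], D.evalFrom_append_singleton _ _ _⟩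

/-- The catenation DFA `A·(B×C)`. -/
noncomputable abbrev catABC (m n p : ℕ) (hm : 0 < m) (hn : 0 < n) (hp : 0 < p) :
    DFA ABC (Fin m × Set (Fin n × Fin p)) :=
  catDFA (XA m hm) (prodDFA (XB n hn) (XC p hp) And)

section Reachability

variable {m n p : ℕ} {hm : 0 < m} {hn : 0 < n} {hp : 0 < p}

theorem IsReachable.a_step {i j : Fin m} {T : Set (Fin n × Fin p)}
    (h : IsReachable (catABC m n p hm hn hp) (i, T)) (hj : cyc i = j) (hj' : j.val ≠ m - 1) :
    IsReachable (catABC m n p hm hn hp) (j, swapRow '' T) := by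
  subst hj
  have h1 := h.step ABC.a
  have h2 : (XA m hm).step i ABC.a ∉ (XA m hm).accept := fun h => hj' (congrArg Fin.val h)
  simp only [catABC, catDFA, if_neg h2] at h1
  exact h1

theorem IsReachable.a_step_last {i j : Fin m} {T : Set (Fin n × Fin p)}
    (h : IsReachable (catABC m n p hm hn hp) (i, T)) (hj : cyc i = j) (hj' : j.val = m - 1) :
    IsReachable (catABC m n p hm hn hp) (j, insert (⟨0, hn⟩, ⟨0, hp⟩) (swapRow '' T)) := by
  subst hj
  have h1 := h.step ABC.a
  have h2 : (XA m hm).step i ABC.a ∈ (XA m hm).accept := Fin.ext hj'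
  simp only [catABC, catDFA, if_pos h2] at h1
  rw [← Set.union_singleton]
  exact h1

theorem IsReachable.b_step {i j : Fin m} {T : Set (Fin n × Fin p)}
    (h : IsReachable (catABC m n p hm hn hp) (i, T)) (hj : transp i = j) (hj' : j.val ≠ m - 1) :
    IsReachable (catABC m n p hm hn hp) (j, shift '' T) := by
  subst hj
  have h1 := h.step ABC.b
  have h2 : (XA m hm).step i ABC.b ∉ (XA m hm).accept := fun h => hj' (congrArg Fin.val h)
  simp only [catABC, catDFA, if_neg h2] at h1
  exact h1

theorem isReachable_of_forall_isReachable_zero (hn2 : 2 ≤ n) {k : ℕ}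
    (h : ∀ T, T.ncard = k → IsReachable (catABC m n p hm hn hp) (⟨0, hm⟩, T))
    (i : ℕ) (hi : i < m - 1) (T : Set (Fin n × Fin p)) (hT : T.ncard = k) :
    IsReachable (catABC m n p hm hn hp) (⟨i, by omega⟩, T) := by
  induction i generalizing T with
  | zero => exact h T hT
  | succ i ih =>
    have hb := swapRow_bijective (p := p) hn2
    rw [← hb.surjective.image_preimage T]
    refine (ih (by omega) _ ((ncard_preimage_of_bijective hb T).trans hT)).a_step
      (Fin.ext ?_) (by simp only; omega)
    rw [val_cyc, if_neg (by simp only; omega)]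

theorem isReachable_last_insert (hm2 : 2 ≤ m) (hn2 : 2 ≤ n) {k : ℕ}
    (h : ∀ T, T.ncard = k → IsReachable (catABC m n p hm hn hp) (⟨0, hm⟩, T))
    (T : Set (Fin n × Fin p)) (hT : T.ncard = k) :
    IsReachable (catABC m n p hm hn hp)
      (⟨m - 1, by omega⟩, insert (⟨0, hn⟩, ⟨0, hp⟩) T) := by
  have hb := swapRow_bijective (p := p) hn2
  rw [← hb.surjective.image_preimage T]
  refine (isReachable_of_forall_isReachable_zero hn2 h (m - 2) (by omega) _
    ((ncard_preimage_of_bijective hb T).trans hT)).a_step_last (Fin.ext ?_) rfl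
  rw [val_cyc, if_neg (by simp only; omega)]
  simp only; omega

theorem isReachable_zero (hm3 : 3 ≤ m) (hn3 : 3 ≤ n) (k : ℕ) :
    ∀ T, T.ncard = k → IsReachable (catABC m n p hm hn hp) (⟨0, hm⟩, T) := by
  have ha := swapRow_bijective (n := n) (p := p) (by omega)
  have hs := shift_bijective (n := n) (p := p)
  have c01 : cyc (⟨0, hm⟩ : Fin m) = ⟨1, by omega⟩ := by
    apply Fin.ext; rw [val_cyc]; simp only; split_ifs <;> omega
  have t01 : transp (⟨0, hm⟩ : Fin m) = ⟨1, by omega⟩ := by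
    apply Fin.ext; rw [val_transp (by omega)]; simp
  have t10 : transp (⟨1, by omega⟩ : Fin m) = ⟨0, hm⟩ := by
    apply Fin.ext; rw [val_transp (by omega)]; simp
  have n0 : (⟨0, hm⟩ : Fin m).val ≠ m - 1 := by simp only; omega
  have n1 : (⟨1, by omega⟩ : Fin m).val ≠ m - 1 := by simp only; omega
  induction k with
  | zero =>
    intro T hT
    rw [Set.ncard_eq_zero] at hT
    subst hT
    refine ⟨[], ?_⟩
    have h : (XA m hm).start ∉ (XA m hm).accept := fun h => n0 (congrArg Fin.val h)
    simp only [DFA.evalFrom_nil, catABC, catDFA, if_neg h]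
    rfl
  | succ k ih =>
    have key : ∀ x : Fin n × Fin p, ∀ T, x ∈ T → T.ncard = k + 1 →
        IsReachable (catABC m n p hm hn hp) (⟨0, hm⟩, T) := by
      refine forall_of_shift_shift_of_shift_swapRow hn3 hp _ ?_ ?_ ?_
      · intro T hx hT
        have hT' := (ncard_preimage_of_bijective ha T).trans hT
        have hx' : ((⟨0, hn⟩, ⟨0, hp⟩) : Fin n × Fin p) ∈ swapRow ⁻¹' T := by
          rw [Set.mem_preimage]
          convert hx using 1
          refine Prod.ext (Fin.ext ?_) rfl
          simp [swapRow, val_transp (show 2 ≤ n by omega)]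
        have h := isReachable_last_insert (by omega) (by omega) ih
          (swapRow ⁻¹' T \ {(⟨0, hn⟩, ⟨0, hp⟩)})
          (by rw [Set.ncard_sdiff_singleton_of_mem hx', hT']; rfl)
        rw [Set.insert_sdiff_singleton, Set.insert_eq_of_mem hx'] at h
        have h' := h.a_step (j := ⟨0, hm⟩)
          (Fin.ext (by rw [val_cyc, if_pos (by simp only; omega)])) n0
        rwa [ha.surjective.image_preimage] at h'
      · intro x hx T hxT hT
        have h := hx (shift ⁻¹' (shift ⁻¹' T)) hxT
          (by rw [ncard_preimage_of_bijective hs, ncard_preimage_of_bijective hs, hT])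
        have h' := (h.b_step t01 n1).b_step t10 n0
        rwa [hs.surjective.image_preimage, hs.surjective.image_preimage] at h'
      · intro x hx T hxT hT
        have h := hx (swapRow ⁻¹' (shift ⁻¹' T)) hxT
          (by rw [ncard_preimage_of_bijective ha, ncard_preimage_of_bijective hs, hT])
        have h' := (h.a_step c01 n1).b_step t10 n0
        rwa [ha.surjective.image_preimage, hs.surjective.image_preimage] at h'
    intro T hT
    obtain ⟨x, hx⟩ := Set.nonempty_of_ncard_ne_zero (s := T) (by omega)
    exact key x T hx hT

end Reachability

theorem statement9 (m n p : ℕ) (hm : 3 ≤ m) (hn : 3 ≤ n) (hp : 3 ≤ p)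
    (i : Fin m) (T : Set (Fin n × Fin p))
    (hT : i.val = m - 1 → ((⟨0, by omega⟩ : Fin n), (⟨0, by omega⟩ : Fin p)) ∈ T) :
    ∃ w : List ABC,
      (catDFA (XA m (by omega)) (prodDFA (XB n (by omega)) (XC p (by omega)) And)).evalFrom
        (catDFA (XA m (by omega)) (prodDFA (XB n (by omega)) (XC p (by omega)) And)).start w
      = (i, T) := by
  by_cases hi : i.val = m - 1
  · have h := isReachable_last_insert (m := m) (n := n) (p := p) (hm := by omega)
      (hn := by omega) (hp := by omega) (by omega) (by omega)
      (isReachable_zero hm hn _) T rfl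
    rw [Set.insert_eq_of_mem (hT hi)] at h
    rw [show i = ⟨m - 1, by omega⟩ from Fin.ext hi]
    exact h
  · exact isReachable_of_forall_isReachable_zero (by omega) (isReachable_zero hm hn _)
      i.val (by omega) T rfl
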